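/- For a strictly positive moment sequence {s_k} with s_0 = 1 and associated Krein–Langer string (L, ω, υ) with masses ω_n, lengths l_n, dipoles υ_n, the Hamburger moment problem is determinate if and only if the series Σ_{n≥0} (l_{n+1} + l_{n+1} w_n² + υ_n) diverges, where w_n := Σ_{k=0}^n ω_k. Equivalently, determinacy holds iff Σ_{n≥0} (|P_n(0)|² + |Q_n(0)|²) = ∞. -/

import Mathlib

open MeasureTheory

noncomputable section

/-- The Hankel determinant `Δ_{0,n} = det (s_{i+j})_{0 ≤ i,j ≤ n}`. -/
def hankel (s : ℕ → ℝ) (n : ℕ) : ℝ :=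
  (Matrix.of fun i j : Fin (n + 1) => s (i.1 + j.1)).det

/-- `Δ_{0,n-1}` with the convention `Δ_{0,-1} = 1`. -/
def hankelPrev (s : ℕ → ℝ) : ℕ → ℝ
  | 0 => 1
  | n + 1 => hankel s n

/-- `ρ` is a solution of the Hamburger moment problem with data `s`. -/
def IsMomentSolution (s : ℕ → ℝ) (ρ : Measure ℝ) : Prop :=
  ∀ k : ℕ, Integrable (fun x : ℝ => x ^ k) ρ ∧ (∫ x, x ^ k ∂ρ) = s k

/-- The orthonormal polynomial of the first kind `P_n`, via the determinant formula. -/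
def Pn (s : ℕ → ℝ) (n : ℕ) (z : ℝ) : ℝ :=
  (Real.sqrt (hankelPrev s n * hankel s n))⁻¹ *
    (Matrix.of fun i j : Fin (n + 1) =>
      if i.1 < n then s (i.1 + j.1) else z ^ j.1).det

/-- The polynomial of the second kind `Q_n(z) = ∫ (P_n(λ) − P_n(z))/(λ − z) dρ(λ)`. -/
def Qn (s : ℕ → ℝ) (ρ : Measure ℝ) (n : ℕ) (z : ℝ) : ℝ :=
  ∫ t, (if t = z then deriv (Pn s n) z else (Pn s n t - Pn s n z) / (t - z)) ∂ρ

section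
open Polynomial
variable {K : Type*} [Field K]

theorem degree_C_lt_degree_X_sub_C (a b : K) : (C a).degree < (X - C b).degree := by
  rw [degree_X_sub_C]
  exact degree_C_le.trans_lt zero_lt_one

/-- The divided difference `(p - p(w)) / (X - w)`, as a linear map in `p`. -/
noncomputable def divDiff (w : K) : K[X] →ₗ[K] K[X] where
  toFun p := p /ₘ (X - C w)
  map_add' p q := by
    refine (div_modByMonic_unique (g := X - C w) _ (C ((p + q).eval w)) (monic_X_sub_C w)
      ⟨?_, degree_C_lt_degree_X_sub_C _ _⟩).1
    rw [eval_add, C_add, ← modByMonic_X_sub_C_eq_C_eval, ← modByMonic_X_sub_C_eq_C_eval]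
    linear_combination modByMonic_add_div p (X - C w) + modByMonic_add_div q (X - C w)
  map_smul' c p := by
    refine (div_modByMonic_unique (g := X - C w) _ (C ((c • p).eval w)) (monic_X_sub_C w)
      ⟨?_, degree_C_lt_degree_X_sub_C _ _⟩).1
    rw [eval_smul, smul_eq_mul, C_mul, ← modByMonic_X_sub_C_eq_C_eval, smul_eq_C_mul,
      smul_eq_C_mul, RingHom.id_apply]
    linear_combination C c * modByMonic_add_div p (X - C w)

theorem eq_eval_add_mul_divDiff (w : K) (p : K[X]) :
    p = C (p.eval w) + (X - C w) * divDiff w p := by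
  conv_lhs => rw [← modByMonic_add_div p (X - C w), modByMonic_X_sub_C_eq_C_eval]
  rfl

theorem degree_divDiff_lt (w : K) {p : K[X]} (hp : p ≠ 0) : (divDiff w p).degree < p.degree :=
  degree_divByMonic_lt p _ hp (by rw [degree_X_sub_C]; exact zero_lt_one)

theorem eq_sum_of_orthonormal (L : K[X] →ₗ[K] K) (P : ℕ → K[X])
    (hdeg : ∀ n, (P n).degree = n)
    (horth : ∀ m n, L (P m * P n) = if m = n then 1 else 0) (n : ℕ) :
    ∀ r : K[X], r.degree < n → r = ∑ k ∈ Finset.range n, L (r * P k) • P k := by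
  induction n with
  | zero => intro r hr; simpa using hr
  | succ n ih =>
    intro r hr
    have hlc : (P n).coeff n ≠ 0 := coeff_ne_zero_of_eq_degree (hdeg n)
    set c := r.coeff n / (P n).coeff n with hc
    have hr' : (r - c • P n).degree < n := by
      rw [degree_lt_iff_coeff_zero]
      intro m hm
      rcases hm.eq_or_lt with rfl | hm
      · simp [hc, hlc]
      · have h1 : r.coeff m = 0 := (degree_lt_iff_coeff_zero _ _).1 hr m hm
        have h2 : (P n).coeff m = 0 := coeff_eq_zero_of_degree_lt (by rw [hdeg]; exact_mod_cast hm)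
        simp [h1, h2]
    have key := ih _ hr'
    have hLn : L ((r - c • P n) * P n) = 0 := by
      rw [key, Finset.sum_mul, map_sum]
      refine Finset.sum_eq_zero fun k hk => ?_
      rw [smul_mul_assoc, map_smul, horth, if_neg (Finset.mem_range.1 hk).ne, smul_zero]
    have hc' : L (r * P n) = c := by
      have := horth n n
      rw [sub_mul, map_sub, smul_mul_assoc, map_smul, this] at hLn
      simpa [sub_eq_zero] using hLn
    rw [Finset.sum_range_succ, hc', ← sub_eq_iff_eq_add]
    refine key.trans (Finset.sum_congr rfl fun k hk => ?_)
    rw [sub_mul, map_sub, smul_mul_assoc, map_smul, horth, if_neg (Finset.mem_range.1 hk).ne']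
    simp

theorem map_mul_eq_zero_of_degree_lt (L : K[X] →ₗ[K] K) (P : ℕ → K[X])
    (hdeg : ∀ n, (P n).degree = n)
    (horth : ∀ m n, L (P m * P n) = if m = n then 1 else 0) {n : ℕ} {r : K[X]}
    (hr : r.degree < n) : L (P n * r) = 0 := by
  rw [eq_sum_of_orthonormal L P hdeg horth n r hr, Finset.mul_sum, map_sum]
  refine Finset.sum_eq_zero fun k hk => ?_
  rw [mul_smul_comm, map_smul, horth, if_neg (Finset.mem_range.1 hk).ne', smul_zero]

theorem divDiff_eq_sum (L : K[X] →ₗ[K] K) (P : ℕ → K[X])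
    (hdeg : ∀ n, (P n).degree = n)
    (horth : ∀ m n, L (P m * P n) = if m = n then 1 else 0) (z : K) (n : ℕ) :
    divDiff z (P n) = ∑ k ∈ Finset.range n,
      (L (divDiff z (P n)) * (P k).eval z - (P n).eval z * L (divDiff z (P k))) • P k := by
  have hne : ∀ n, P n ≠ 0 := fun n h => by simpa [h] using hdeg n
  have hlt : ∀ n, (divDiff z (P n)).degree < n := fun n => by
    rw [← hdeg n]
    exact degree_divDiff_lt z (hne n)
  have hdiv : ∀ n, P n = C ((P n).eval z) + (X - C z) * (divDiff z (P n)) := fun n =>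
    eq_eval_add_mul_divDiff z _
  conv_lhs => rw [eq_sum_of_orthonormal L P hdeg horth n _ (hlt n)]
  refine Finset.sum_congr rfl fun k hk => ?_
  congr 1
  have hkn := Finset.mem_range.1 hk
  have h0 : L (P n * (divDiff z (P k))) = 0 :=
    map_mul_eq_zero_of_degree_lt L P hdeg horth ((hlt k).trans (by exact_mod_cast hkn))
  have e : divDiff z (P n) * P k = (P k).eval z • (divDiff z (P n))
      + P n * (divDiff z (P k)) - (P n).eval z • (divDiff z (P k)) := by
    rw [smul_eq_C_mul, smul_eq_C_mul]
    linear_combination (divDiff z (P n)) * hdiv k - (divDiff z (P k)) * hdiv n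
  rw [e, map_sub, map_add, map_smul, map_smul, h0]
  simp [mul_comm]

theorem eval_ne_zero_or_eval_succ_ne_zero (L : K[X] →ₗ[K] K) (P : ℕ → K[X])
    (hdeg : ∀ n, (P n).degree = n)
    (horth : ∀ m n, L (P m * P n) = if m = n then 1 else 0) (z : K) (n : ℕ) :
    (P n).eval z ≠ 0 ∨ (P (n + 1)).eval z ≠ 0 := by
  by_contra! h
  have e := divDiff_eq_sum L P hdeg horth z (n + 1)
  rw [Finset.sum_range_succ, h.1, h.2] at e
  have hd : (divDiff z (P (n + 1))).degree = n := by
    have := degree_add_divByMonic (p := P (n + 1)) (monic_X_sub_C z) (by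
      rw [hdeg, degree_X_sub_C]; exact_mod_cast Nat.le_add_left 1 n)
    change _ + (divDiff z (P (n + 1))).degree = _ at this
    have hne : divDiff z (P (n + 1)) ≠ 0 := fun h => by
      rw [h, hdeg, degree_zero, WithBot.add_bot] at this
      exact absurd this.symm (WithBot.coe_ne_bot (a := n + 1))
    rw [hdeg, degree_X_sub_C, degree_eq_natDegree hne] at this
    rw [degree_eq_natDegree hne]
    norm_cast at this ⊢
    omega
  have hlt : (divDiff z (P (n + 1))).degree < n := by
    rw [e]
    rw [degree_lt_iff_coeff_zero]
    intro m hm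
    rw [coeff_add, finsetSum_coeff, Finset.sum_eq_zero]
    · simp
    · intro k hk
      rw [coeff_smul, coeff_eq_zero_of_degree_lt, smul_zero]
      rw [hdeg]
      exact_mod_cast (Finset.mem_range.1 hk).trans_le hm
  exact hlt.ne hd

theorem eval_eq_add_sum (L : K[X] →ₗ[K] K) (P : ℕ → K[X])
    (hdeg : ∀ n, (P n).degree = n)
    (horth : ∀ m n, L (P m * P n) = if m = n then 1 else 0) (z w : K) (n : ℕ) :
    (P n).eval w = (P n).eval z + (w - z) * ∑ k ∈ Finset.range n,
      (L (divDiff z (P n)) * (P k).eval z - (P n).eval z * L (divDiff z (P k)))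
        * (P k).eval w := by
  have h := divDiff_eq_sum L P hdeg horth z n
  have hdiv : P n = C ((P n).eval z) + (X - C z) * (divDiff z (P n)) :=
    eq_eval_add_mul_divDiff z _
  conv_lhs => rw [hdiv, h]
  simp [eval_finsetSum]

theorem map_divDiff_eq_add_sum (L : K[X] →ₗ[K] K) (P : ℕ → K[X])
    (hdeg : ∀ n, (P n).degree = n)
    (horth : ∀ m n, L (P m * P n) = if m = n then 1 else 0) (z w : K) (n : ℕ) :
    L (divDiff w (P n)) = L (divDiff z (P n)) + (w - z) * ∑ k ∈ Finset.range n,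
      (L (divDiff z (P n)) * (P k).eval z - (P n).eval z * L (divDiff z (P k)))
        * L (divDiff w (P k)) := by
  have h := divDiff_eq_sum L P hdeg horth z n
  have e : divDiff w (P n) = divDiff z (P n) + (w - z) • divDiff w (divDiff z (P n)) := by
    refine mul_left_cancel₀ (X_sub_C_ne_zero w) ?_
    have h1 := eq_eval_add_mul_divDiff z (P n)
    have h2 := eq_eval_add_mul_divDiff w (P n)
    have h3 := eq_eval_add_mul_divDiff w (divDiff z (P n))
    have h4 : (P n).eval w = (P n).eval z + (w - z) * (divDiff z (P n)).eval w := by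
      conv_lhs => rw [h1]
      simp
    have h5 := congrArg C h4
    simp only [C_add, C_mul, C_sub] at h5
    rw [smul_eq_C_mul, C_sub]
    linear_combination h1 - h2 + (C w - C z) * h3 - h5
  have e2 : divDiff w (divDiff z (P n)) = ∑ k ∈ Finset.range n,
      (L (divDiff z (P n)) * (P k).eval z - (P n).eval z * L (divDiff z (P k))) •
        divDiff w (P k) := by
    conv_lhs => rw [h]
    rw [map_sum]
    simp
  rw [e, map_add, map_smul, e2, map_sum]
  simp
end

section
open Polynomial

/-- The functional on polynomials with moments `s`. -/
def momentFunctional {K : Type*} [Field K] (s : ℕ → K) : K[X] →ₗ[K] K :=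
  lsum fun k => s k • LinearMap.id

theorem momentFunctional_C_mul_X_pow {K : Type*} [Field K] (s : ℕ → K) (a : K) (k : ℕ) :
    momentFunctional s (C a * X ^ k) = a * s k := by
  rw [momentFunctional, C_mul_X_pow_eq_monomial, lsum_apply, sum_monomial_index _ _ (by simp)]
  simp [mul_comm]

theorem momentFunctional_X_pow {K : Type*} [Field K] (s : ℕ → K) (k : ℕ) :
    momentFunctional s (X ^ k) = s k := by
  simpa using momentFunctional_C_mul_X_pow s 1 k

theorem momentFunctional_map {K F : Type*} [Field K] [Field F] (φ : K →+* F) (s : ℕ → K)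
    (p : K[X]) : momentFunctional (fun k => φ (s k)) (p.map φ) = φ (momentFunctional s p) := by
  induction p using Polynomial.induction_on' with
  | add p q hp hq => simp [hp, hq]
  | monomial n a =>
    rw [← C_mul_X_pow_eq_monomial, Polynomial.map_mul, Polynomial.map_pow, map_C, map_X,
      momentFunctional_C_mul_X_pow, momentFunctional_C_mul_X_pow, map_mul]

/-- The cofactors along the last row of a bordered Hankel matrix. -/
def hankelCofactor (s : ℕ → ℝ) (n : ℕ) (j : Fin (n + 1)) : ℝ :=
  (-1) ^ (n + j.1) * (Matrix.of fun i l : Fin n => s (i.1 + (j.succAbove l).1)).det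

theorem det_bordered (s : ℕ → ℝ) (n : ℕ) (v : ℕ → ℝ) :
    (Matrix.of fun i j : Fin (n + 1) => if i.1 < n then s (i.1 + j.1) else v j.1).det
      = ∑ j, hankelCofactor s n j * v j.1 := by
  rw [Matrix.det_succ_row _ (Fin.last n)]
  refine Finset.sum_congr rfl fun j _ => ?_
  rw [hankelCofactor, mul_right_comm]
  rw [Fin.succAbove_last]
  congr 2
  · congr 1
    ext i l
    simp
  · simp

theorem hankelCofactor_last (s : ℕ → ℝ) (n : ℕ) :
    hankelCofactor s n (Fin.last n) = hankelPrev s n := by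
  rw [hankelCofactor, Fin.val_last, ← two_mul, pow_mul, neg_one_sq, one_pow, one_mul]
  cases n with
  | zero => simp [hankelPrev]
  | succ n => simp [hankelPrev, hankel]

theorem sum_hankelCofactor_mul (s : ℕ → ℝ) (n m : ℕ) (hm : m ≤ n) :
    ∑ j, hankelCofactor s n j * s (m + j.1) = if m = n then hankel s n else 0 := by
  rw [← det_bordered s n fun j => s (m + j)]
  split_ifs with h
  · subst h
    rw [hankel]
    congr 1
    ext i j
    simp only [Matrix.of_apply]
    split_ifs with hi
    · rfl
    · rw [show i.1 = m by omega]
  · refine Matrix.det_zero_of_row_eq (i := ⟨m, by omega⟩) (j := Fin.last n)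
      (fun h' => h (congrArg Fin.val h')) ?_
    ext j
    simp [show m < n by omega]

/-- The orthonormal polynomial `P_n` as an element of `ℝ[X]`. -/
def orthPoly (s : ℕ → ℝ) (n : ℕ) : ℝ[X] :=
  (√(hankelPrev s n * hankel s n))⁻¹ • ∑ j, C (hankelCofactor s n j) * X ^ j.1

theorem eval_orthPoly (s : ℕ → ℝ) (n : ℕ) (z : ℝ) : (orthPoly s n).eval z = Pn s n z := by
  rw [orthPoly, Pn, det_bordered s n fun j => z ^ j]
  simp [eval_finsetSum]

theorem hankelPrev_pos {s : ℕ → ℝ} (h0 : ∀ n, 0 < hankel s n) (n : ℕ) : 0 < hankelPrev s n := by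
  cases n with
  | zero => exact one_pos
  | succ n => exact h0 n

theorem coeff_orthPoly_self (s : ℕ → ℝ) (n : ℕ) :
    (orthPoly s n).coeff n = (√(hankelPrev s n * hankel s n))⁻¹ * hankelPrev s n := by
  rw [orthPoly, coeff_smul, finsetSum_coeff, Fin.sum_univ_castSucc]
  simp only [coeff_C_mul_X_pow, Fin.val_castSucc, Fin.val_last, if_true, hankelCofactor_last]
  rw [Finset.sum_eq_zero fun i _ => if_neg i.2.ne', zero_add, smul_eq_mul]

theorem degree_orthPoly {s : ℕ → ℝ} (h0 : ∀ n, 0 < hankel s n) (n : ℕ) :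
    (orthPoly s n).degree = n := by
  refine le_antisymm ?_ (le_degree_of_ne_zero ?_)
  · refine (degree_smul_le _ _).trans ((degree_sum_le _ _).trans (Finset.sup_le fun j _ => ?_))
    exact (degree_C_mul_X_pow_le _ _).trans (by exact_mod_cast Nat.lt_succ_iff.1 j.2)
  · rw [coeff_orthPoly_self]
    have := hankelPrev_pos h0 n
    have := h0 n
    positivity

theorem momentFunctional_orthPoly_mul (s : ℕ → ℝ) (n : ℕ) (q : ℝ[X]) (hq : q.degree ≤ n) :
    momentFunctional s (orthPoly s n * q)
      = (√(hankelPrev s n * hankel s n))⁻¹ * (hankel s n * q.coeff n) := by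
  have key : ∀ m ≤ n, ∀ a : ℝ, momentFunctional s (orthPoly s n * (C a * X ^ m))
      = (√(hankelPrev s n * hankel s n))⁻¹ * (if m = n then hankel s n * a else 0) := by
    intro m hm a
    have e : orthPoly s n * (C a * X ^ m) = (√(hankelPrev s n * hankel s n))⁻¹ •
        ∑ j, C (a * hankelCofactor s n j) * X ^ (m + j.1) := by
      rw [orthPoly, smul_mul_assoc, Finset.sum_mul]
      congr 1
      refine Finset.sum_congr rfl fun j _ => ?_
      rw [C_mul]
      ring
    rw [e, map_smul, map_sum, smul_eq_mul]
    simp only [momentFunctional_C_mul_X_pow, mul_assoc]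
    rw [← Finset.mul_sum, sum_hankelCofactor_mul s n m hm]
    split_ifs <;> ring
  have hq' : q.natDegree < n + 1 := Nat.lt_succ_iff.2 (natDegree_le_of_degree_le hq)
  conv_lhs => rw [as_sum_range_C_mul_X_pow' q hq', Finset.mul_sum, map_sum]
  rw [Finset.sum_congr rfl fun m hm => key m (Nat.lt_succ_iff.1 (Finset.mem_range.1 hm)) _,
    Finset.sum_range_succ, Finset.sum_eq_zero fun m hm => ?_]
  · simp
  · rw [if_neg (Finset.mem_range.1 hm).ne, mul_zero]

theorem momentFunctional_orthPoly_mul_orthPoly {s : ℕ → ℝ} (h0 : ∀ n, 0 < hankel s n) (m n : ℕ) :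
    momentFunctional s (orthPoly s m * orthPoly s n) = if m = n then 1 else 0 := by
  have hlt : ∀ m n : ℕ, m < n → momentFunctional s (orthPoly s n * orthPoly s m) = 0 := by
    intro m n h
    have hd : (orthPoly s m).degree < n := by
      rw [degree_orthPoly h0]
      exact_mod_cast h
    rw [momentFunctional_orthPoly_mul s n _ hd.le, coeff_eq_zero_of_degree_lt hd]
    simp
  rcases lt_trichotomy m n with h | rfl | h
  · rw [mul_comm, hlt m n h, if_neg h.ne]
  · rw [momentFunctional_orthPoly_mul s m _ (degree_orthPoly h0 m).le, coeff_orthPoly_self,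
      if_pos rfl]
    have h1 := mul_pos (hankelPrev_pos h0 m) (h0 m)
    have h2 := Real.sq_sqrt h1.le
    have h3 := Real.sqrt_pos.2 h1
    field_simp
    linarith
  · rw [hlt n m h, if_neg h.ne']

theorem IsMomentSolution.integrable_eval {s : ℕ → ℝ} {μ : Measure ℝ} (h : IsMomentSolution s μ)
    (p : ℝ[X]) : Integrable (fun x => p.eval x) μ := by
  simp only [eval_eq_sum_range]
  exact integrable_finsetSum _ fun i _ => (h i).1.const_mul _

theorem IsMomentSolution.integral_eval {s : ℕ → ℝ} {μ : Measure ℝ} (h : IsMomentSolution s μ)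
    (p : ℝ[X]) : ∫ x, p.eval x ∂μ = momentFunctional s p := by
  conv_rhs => rw [as_sum_range_C_mul_X_pow p, map_sum]
  simp only [eval_eq_sum_range, momentFunctional_C_mul_X_pow]
  rw [integral_finsetSum _ fun i _ => (h i).1.const_mul _]
  refine Finset.sum_congr rfl fun i _ => ?_
  rw [integral_const_mul, (h i).2]

theorem IsMomentSolution.isFiniteMeasure {s : ℕ → ℝ} {μ : Measure ℝ}
    (h : IsMomentSolution s μ) : IsFiniteMeasure μ := by
  have := (h 0).1
  simpa [integrable_const_iff] using this

theorem Qn_eq_momentFunctional {s : ℕ → ℝ} {μ : Measure ℝ} (h : IsMomentSolution s μ) (n : ℕ)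
    (z : ℝ) : Qn s μ n z = momentFunctional s (divDiff z (orthPoly s n)) := by
  rw [Qn, ← h.integral_eval]
  congr 1
  ext t
  have e := eq_eval_add_mul_divDiff z (orthPoly s n)
  have hP : Pn s n = fun x => (orthPoly s n).eval x := funext fun x => (eval_orthPoly s n x).symm
  split_ifs with ht
  · rw [hP, Polynomial.deriv, ht]
    conv_lhs => rw [e]
    simp
  · rw [← eval_orthPoly, ← eval_orthPoly, div_eq_iff (sub_ne_zero.2 ht)]
    conv_lhs => rw [e]
    simp [mul_comm]

/-- Bessel-type bound for a linear functional on polynomials. -/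
theorem sq_map_le_of_sum_le (L : ℝ[X] →ₗ[ℝ] ℝ) (P : ℕ → ℝ[X])
    (hdeg : ∀ n, (P n).degree = n)
    (horth : ∀ m n, L (P m * P n) = if m = n then 1 else 0) (φ : ℝ[X] →ₗ[ℝ] ℝ) {S : ℝ}
    (hS : ∀ N, ∑ n ∈ Finset.range N, φ (P n) ^ 2 ≤ S) (r : ℝ[X]) :
    φ r ^ 2 ≤ S * L (r ^ 2) := by
  have hr : r.degree < (r.natDegree + 1 : ℕ) :=
    degree_le_natDegree.trans_lt (by exact_mod_cast Nat.lt_succ_self _)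
  set N := r.natDegree + 1
  have e := eq_sum_of_orthonormal L P hdeg horth N r hr
  set c : ℕ → ℝ := fun k => L (r * P k)
  have h1 : φ r = ∑ k ∈ Finset.range N, c k * φ (P k) := by
    conv_lhs => rw [e, map_sum]
    simp [c]
  have h2 : L (r ^ 2) = ∑ k ∈ Finset.range N, c k ^ 2 := by
    have : r ^ 2 = ∑ k ∈ Finset.range N, c k • (r * P k) := by
      conv_lhs => rw [sq]; arg 2; rw [e]
      rw [Finset.mul_sum]
      simp [c]
    rw [this, map_sum]
    exact Finset.sum_congr rfl fun k _ => by rw [map_smul, smul_eq_mul, sq]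
  rw [h1, h2, mul_comm]
  refine (Finset.sum_mul_sq_le_sq_mul_sq _ _ _).trans ?_
  gcongr
  exact hS N
end

section
open Polynomial Filter Topology CompactlySupported

theorem exists_eq_sq_add_sq_of_eval_nonneg (p : ℝ[X]) (hp : ∀ x, 0 ≤ p.eval x) :
    ∃ a b : ℝ[X], p = a ^ 2 + b ^ 2 := by
  induction hn : p.natDegree using Nat.strong_induction_on generalizing p with
  | _ n ih =>
  subst hn
  by_cases h0 : p.natDegree = 0
  · obtain ⟨c, rfl⟩ := natDegree_eq_zero.1 h0
    refine ⟨C √c, 0, ?_⟩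
    have hc : 0 ≤ c := by simpa using hp 0
    rw [← C_pow, Real.sq_sqrt hc]
    simp
  have hp0 : p ≠ 0 := fun h => h0 (by simp [h])
  obtain ⟨z, hz⟩ := Complex.exists_root (f := p.map (algebraMap ℝ ℂ)) (by
    rw [degree_map]; exact natDegree_pos_iff_degree_pos.1 (Nat.pos_of_ne_zero h0))
  have hz' : aeval z p = 0 := by rwa [IsRoot, eval_map_algebraMap] at hz
  by_cases him : z.im = 0
  · obtain ⟨r, rfl⟩ : ∃ r : ℝ, z = r := ⟨z.re, Complex.ext rfl (by simpa using him)⟩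
    have hr : p.eval r = 0 := by
      rw [← Complex.coe_algebraMap, aeval_algebraMap_apply] at hz'
      simpa using hz'
    have hr' : (derivative p).eval r = 0 := by
      rw [← Polynomial.deriv]
      refine IsLocalMin.deriv_eq_zero (Eventually.of_forall fun x => ?_)
      simpa only [hr] using hp x
    have hdvd : (X - C r) ^ 2 ∣ p :=
      (le_rootMultiplicity_iff hp0).1 ((one_lt_rootMultiplicity_iff_isRoot hp0).2 ⟨hr, hr'⟩)
    obtain ⟨q, rfl⟩ := hdvd
    have hq0 : q ≠ 0 := right_ne_zero_of_mul hp0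
    have hq : ∀ x, 0 ≤ q.eval x := by
      have hcl : IsClosed {x | 0 ≤ q.eval x} := isClosed_le continuous_const q.continuous
      have hsub : ({r}ᶜ : Set ℝ) ⊆ {x | 0 ≤ q.eval x} := fun x hx => by
        have h := hp x
        rw [eval_mul, eval_pow] at h
        refine nonneg_of_mul_nonneg_right h ?_
        rw [eval_sub, eval_X, eval_C]
        exact (sq_pos_iff.2 (sub_ne_zero.2 hx))
      intro x
      have := hcl.closure_subset_iff.2 hsub
      rw [(dense_compl_singleton r).closure_eq] at this
      exact this (Set.mem_univ x)
    obtain ⟨a, b, hab⟩ := ih q.natDegree (by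
      rw [natDegree_mul (pow_ne_zero _ (X_sub_C_ne_zero r)) hq0]
      simp) q hq rfl
    exact ⟨(X - C r) * a, (X - C r) * b, by rw [hab]; ring⟩
  · obtain ⟨q, hpq⟩ := p.quadratic_dvd_of_aeval_eq_zero_im_ne_zero hz' him
    have hquad : (X ^ 2 - C (2 * z.re) * X + C (‖z‖ ^ 2) : ℝ[X])
        = (X - C z.re) ^ 2 + C z.im ^ 2 := by
      rw [Complex.sq_norm, Complex.normSq_apply]
      simp only [C_mul, C_add, map_ofNat]
      ring
    rw [hquad] at hpq
    subst hpq
    have hq0 : q ≠ 0 := right_ne_zero_of_mul hp0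
    have hq : ∀ x, 0 ≤ q.eval x := fun x => by
      have h := hp x
      rw [eval_mul] at h
      refine nonneg_of_mul_nonneg_right h ?_
      simp only [eval_add, eval_pow, eval_sub, eval_X, eval_C]
      have : 0 < z.im ^ 2 := by positivity
      positivity
    have hdeg : ((X - C z.re) ^ 2 + C z.im ^ 2 : ℝ[X]).natDegree = 2 := by
      rw [← C_pow, natDegree_add_C]
      simp
    obtain ⟨a, b, hab⟩ := ih q.natDegree (by
      rw [natDegree_mul (left_ne_zero_of_mul hp0) hq0, hdeg]
      omega) q hq rfl
    exact ⟨(X - C z.re) * a - C z.im * b, (X - C z.re) * b + C z.im * a, by rw [hab]; ring⟩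

/-- A continuous cutoff function, equal to `1` on `[-R, R]` and supported in `[-2R, 2R]`. -/
def cutoff (R x : ℝ) : ℝ := max 0 (min 1 (2 - |x| / R))

theorem continuous_cutoff (R : ℝ) : Continuous (cutoff R) := by
  unfold cutoff
  fun_prop

theorem cutoff_nonneg (R x : ℝ) : 0 ≤ cutoff R x := le_max_left _ _

theorem cutoff_le_one (R x : ℝ) : cutoff R x ≤ 1 := max_le zero_le_one (min_le_left _ _)

theorem cutoff_eq_one {R x : ℝ} (hR : 0 < R) (hx : |x| ≤ R) : cutoff R x = 1 := by
  have : |x| / R ≤ 1 := (div_le_one hR).2 hx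
  rw [cutoff, min_eq_left (by linarith), max_eq_right zero_le_one]

theorem cutoff_eq_zero {R x : ℝ} (hR : 0 < R) (hx : 2 * R ≤ |x|) : cutoff R x = 0 := by
  have : 2 ≤ |x| / R := (le_div_iff₀ hR).2 hx
  exact max_eq_left ((min_le_right _ _).trans (by linarith))

/-- The monomial `x ^ k` multiplied by the cutoff at radius `R`. -/
def cutoffPow (R : ℝ) (hR : 0 < R) (k : ℕ) : C_c(ℝ, ℝ) where
  toFun x := x ^ k * cutoff R x
  continuous_toFun := by
    have := continuous_cutoff R
    fun_prop
  hasCompactSupport' := by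
    refine HasCompactSupport.intro (isCompact_Icc (a := -(2 * R)) (b := 2 * R)) fun x hx => ?_
    rw [cutoff_eq_zero hR, mul_zero]
    by_contra! h
    exact hx (Set.mem_Icc.2 (abs_le.1 h.le))

theorem cutoffPow_apply (R : ℝ) (hR : 0 < R) (k : ℕ) (x : ℝ) :
    cutoffPow R hR k x = x ^ k * cutoff R x := rfl

theorem abs_pow_sub_cutoffPow_le (R : ℝ) (hR : 1 ≤ R) (k : ℕ) (x : ℝ) :
    |x ^ k - cutoffPow R (by linarith) k x| ≤ x ^ (2 * (k + 1)) / R := by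
  have hR0 : 0 < R := by linarith
  rw [cutoffPow_apply]
  rcases le_total |x| R with h | h
  · rw [cutoff_eq_one hR0 h, mul_one, sub_self, abs_zero, pow_mul]
    positivity
  · rw [← mul_one_sub, abs_mul, abs_of_nonneg (sub_nonneg.2 (cutoff_le_one R x)), le_div_iff₀ hR0,
      abs_pow, ← (even_two_mul (k + 1)).pow_abs]
    have h1 : 1 ≤ |x| := hR.trans h
    calc |x| ^ k * (1 - cutoff R x) * R ≤ |x| ^ k * 1 * |x| := by
          gcongr
          linarith [cutoff_nonneg R x]
      _ = |x| ^ (k + 1) := by ring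
      _ ≤ |x| ^ (2 * (k + 1)) := pow_le_pow_right₀ h1 (by omega)

/-- Positive extension of a functional on polynomials to compactly supported functions. -/
theorem exists_positive_extension (L : ℝ[X] →ₗ[ℝ] ℝ) (hL : ∀ p, 0 ≤ L (p ^ 2)) :
    ∃ Λ : C_c(ℝ, ℝ) →ₚ[ℝ] ℝ, ∀ (p : ℝ[X]) (f : C_c(ℝ, ℝ)),
      (∀ x, f x ≤ p.eval x) → Λ f ≤ L p := by
  have hL' : ∀ p : ℝ[X], (∀ x, 0 ≤ p.eval x) → 0 ≤ L p := fun p hp => by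
    obtain ⟨a, b, rfl⟩ := exists_eq_sq_add_sq_of_eval_nonneg p hp
    rw [map_add]
    exact add_nonneg (hL a) (hL b)
  let s : PointedCone ℝ (ℝ[X] × C_c(ℝ, ℝ)) :=
    { carrier := {y | ∀ x, 0 ≤ y.1.eval x + y.2 x}
      add_mem' := fun {a b} ha hb x => by
        have h1 := ha x
        have h2 := hb x
        simp only [Prod.fst_add, Prod.snd_add, eval_add, CompactlySupportedContinuousMap.add_apply]
        linarith
      zero_mem' := fun x => by simp
      smul_mem' := fun c a ha x => by
        have h1 := mul_nonneg c.2 (ha x)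
        rw [mul_add] at h1
        simp only [Prod.smul_fst, Prod.smul_snd, eval_smul]
        exact h1 }
  have hs : ∀ y : ℝ[X] × C_c(ℝ, ℝ), y ∈ s ↔ ∀ x, 0 ≤ y.1.eval x + y.2 x := fun y => Iff.rfl
  let f : (ℝ[X] × C_c(ℝ, ℝ)) →ₗ.[ℝ] ℝ :=
    { domain := LinearMap.ker (LinearMap.snd ℝ ℝ[X] C_c(ℝ, ℝ))
      toFun := (L ∘ₗ LinearMap.fst ℝ ℝ[X] C_c(ℝ, ℝ)).domRestrict _ }
  have hf : ∀ y : f.domain, f y = L y.1.1 := fun y => rfl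
  have hd : ∀ y, y ∈ f.domain ↔ y.2 = 0 := fun y => by simp [f]
  obtain ⟨g, hg, hgs⟩ := riesz_extension s f
    (fun y hy => by
      rw [hf]
      refine hL' _ fun x => ?_
      have := (hs _).1 hy x
      rw [(hd _).1 y.2] at this
      simpa using this)
    (fun y => by
      obtain ⟨M, hM⟩ := y.2.hasCompactSupport.exists_bound_of_continuous y.2.continuous
      refine ⟨⟨(C M - y.1, 0), (hd _).2 rfl⟩, (hs _).2 fun x => ?_⟩
      have := (abs_le.1 (hM x)).1
      simp
      linarith)
  refine ⟨PositiveLinearMap.mk₀ (g ∘ₗ LinearMap.inr ℝ _ _) fun h hh => ?_, fun p h hp => ?_⟩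
  · refine hgs _ ((hs _).2 fun x => ?_)
    have : 0 ≤ h x := hh x
    simpa using this
  · have h1 : g (p, 0) = L p := hg ⟨(p, 0), (hd _).2 rfl⟩
    have h2 : 0 ≤ g (p, -h) := hgs _ ((hs _).2 fun x => by simpa using hp x)
    have h3 : ((p, -h) : ℝ[X] × C_c(ℝ, ℝ)) = (p, 0) - (0, h) := by simp
    rw [h3, map_sub, h1] at h2
    change g (0, h) ≤ L p
    linarith

/-- **Hamburger's theorem**: a functional on polynomials that is nonnegative on squares is
represented by a measure. -/
theorem exists_measure_of_nonneg_sq (L : ℝ[X] →ₗ[ℝ] ℝ) (hL : ∀ p, 0 ≤ L (p ^ 2)) :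
    ∃ μ : Measure ℝ, ∀ k : ℕ, Integrable (fun x : ℝ => x ^ k) μ ∧ ∫ x, x ^ k ∂μ = L (X ^ k) := by
  obtain ⟨Λ, hΛ⟩ := exists_positive_extension L hL
  set μ := RealRMK.rieszMeasure Λ with hμ
  have hint : ∀ f : C_c(ℝ, ℝ), ∫ x, f x ∂μ = Λ f := RealRMK.integral_rieszMeasure Λ
  have hintegrable : ∀ f : C_c(ℝ, ℝ), Integrable f μ := fun f =>
    f.continuous.integrable_of_hasCompactSupport f.hasCompactSupport
  have heven : ∀ k : ℕ, Integrable (fun x : ℝ => x ^ (2 * k)) μ := fun k => by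
    have hcov : AECover μ atTop fun n : ℕ => Set.Icc (-((n : ℝ) + 1)) (n + 1) := by
      have h1 : Tendsto (fun n : ℕ => (n : ℝ) + 1) atTop atTop :=
        tendsto_atTop_add_const_right _ _ tendsto_natCast_atTop_atTop
      exact aecover_Icc (tendsto_neg_atTop_atBot.comp h1) h1
    refine hcov.integrable_of_integral_norm_bounded (L (X ^ (2 * k)))
      (fun n => (by fun_prop : Continuous fun x : ℝ => x ^ (2 * k)).integrableOn_Icc)
      (Eventually.of_forall fun n => ?_)
    have hn : (0 : ℝ) < n + 1 := by positivity
    have hnn : ∀ x : ℝ, 0 ≤ cutoffPow (n + 1) hn (2 * k) x := fun x => by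
      rw [cutoffPow_apply, pow_mul]
      exact mul_nonneg (by positivity) (cutoff_nonneg _ _)
    calc ∫ x in Set.Icc (-((n : ℝ) + 1)) (n + 1), ‖x ^ (2 * k)‖ ∂μ
        = ∫ x in Set.Icc (-((n : ℝ) + 1)) (n + 1), cutoffPow (n + 1) hn (2 * k) x ∂μ := by
          refine setIntegral_congr_fun measurableSet_Icc fun x hx => ?_
          simp only [cutoffPow_apply]
          rw [cutoff_eq_one hn (abs_le.2 hx), mul_one, Real.norm_of_nonneg]
          rw [pow_mul]
          positivity
      _ ≤ ∫ x, cutoffPow (n + 1) hn (2 * k) x ∂μ :=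
          setIntegral_le_integral (hintegrable _) (Eventually.of_forall hnn)
      _ = Λ (cutoffPow (n + 1) hn (2 * k)) := hint _
      _ ≤ L (X ^ (2 * k)) := hΛ _ _ fun x => by
          rw [cutoffPow_apply, eval_pow, eval_X, pow_mul]
          exact mul_le_of_le_one_right (by positivity) (cutoff_le_one _ _)
  have hk : ∀ k : ℕ, Integrable (fun x : ℝ => x ^ k) μ := fun k => by
    refine ((heven 0).add (heven k)).mono' (by fun_prop) (Eventually.of_forall fun x => ?_)
    rw [Real.norm_eq_abs, abs_pow, Pi.add_apply, ← (even_two_mul k).pow_abs, mul_comm 2 k,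
      pow_mul |x| k 2]
    simp only [mul_zero, pow_zero]
    nlinarith [sq_nonneg (|x| ^ k - 1)]
  refine ⟨μ, fun k => ⟨hk k, ?_⟩⟩
  set D := ∫ x, x ^ (2 * (k + 1)) ∂μ with hD
  set E := L (X ^ (2 * (k + 1))) with hE
  have hb : ∀ R : ℝ, 1 ≤ R → |∫ x, x ^ k ∂μ - L (X ^ k)| ≤ (D + E) / R := fun R hR => by
    have hR0 : 0 < R := by linarith
    have hle := abs_pow_sub_cutoffPow_le R hR k
    set F := cutoffPow R hR0 k with hF
    have h1 : |∫ x, x ^ k ∂μ - Λ F| ≤ D / R := by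
      rw [← hint, ← integral_sub (hk k) (hintegrable F), hD, ← integral_div]
      exact (abs_integral_le_integral_abs).trans
        (integral_mono ((hk k).sub (hintegrable F)).abs ((heven (k + 1)).div_const R) hle)
    have h2 : Λ F ≤ L (X ^ k) + E / R := by
      have h := hΛ (X ^ k + R⁻¹ • X ^ (2 * (k + 1))) F fun x => by
        have := (abs_le.1 (hle x)).1
        simp only [eval_add, eval_pow, eval_X, eval_smul, smul_eq_mul]
        rw [div_eq_inv_mul] at this
        linarith
      rw [map_add, map_smul, smul_eq_mul, ← div_eq_inv_mul] at h
      exact h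
    have h3 : L (X ^ k) - E / R ≤ Λ F := by
      have h := hΛ (R⁻¹ • X ^ (2 * (k + 1)) - X ^ k) (-F) fun x => by
        have := (abs_le.1 (hle x)).2
        simp only [eval_sub, eval_pow, eval_X, eval_smul, smul_eq_mul,
          CompactlySupportedContinuousMap.neg_apply]
        rw [div_eq_inv_mul] at this
        linarith
      rw [map_sub, map_smul, smul_eq_mul, ← div_eq_inv_mul, map_neg] at h
      linarith
    rw [add_div]
    rw [abs_le] at h1 ⊢
    constructor <;> linarith [h1.1, h1.2]
  have hlim : Tendsto (fun R : ℝ => (D + E) / R) atTop (𝓝 0) :=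
    tendsto_const_nhds.div_atTop tendsto_id
  have := ge_of_tendsto hlim ((eventually_ge_atTop 1).mono hb)
  exact sub_eq_zero.1 (abs_eq_zero.1 (le_antisymm this (abs_nonneg _)))
end

section
open Polynomial

theorem divDiff_C_add_mul {K : Type*} [Field K] (w c : K) (q : K[X]) :
    divDiff w (C c + (X - C w) * q) = q :=
  (div_modByMonic_unique (g := X - C w) q (C c) (monic_X_sub_C w)
    ⟨rfl, degree_C_lt_degree_X_sub_C _ _⟩).1

/-- If `P_n(0)` is square summable, some solution has an atom at the origin. -/
theorem exists_isMomentSolution_singleton_zero_ne_zero {s : ℕ → ℝ} {S : ℝ} (hS : 0 < S)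
    (h : ∀ p : ℝ[X], p.eval 0 ^ 2 ≤ S * momentFunctional s (p ^ 2)) :
    ∃ μ : Measure ℝ, IsMomentSolution s μ ∧ μ {0} ≠ 0 := by
  obtain ⟨μ, hμ⟩ := exists_measure_of_nonneg_sq (momentFunctional s - S⁻¹ • leval 0) fun p => by
    have := h p
    simp only [LinearMap.sub_apply, LinearMap.smul_apply, leval_apply, eval_pow, smul_eq_mul]
    rw [sub_nonneg, inv_mul_le_iff₀ hS]
    exact this
  refine ⟨μ + ENNReal.ofReal S⁻¹ • Measure.dirac 0, fun k => ?_, ?_⟩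
  · have hd : Integrable (fun x : ℝ => x ^ k) (ENNReal.ofReal S⁻¹ • Measure.dirac 0) :=
      (integrable_dirac (by simp)).smul_measure ENNReal.ofReal_ne_top
    refine ⟨(hμ k).1.add_measure hd, ?_⟩
    rw [integral_add_measure (hμ k).1 hd, (hμ k).2, integral_smul_measure, integral_dirac,
      ENNReal.toReal_ofReal (inv_nonneg.2 hS.le)]
    simp [momentFunctional_X_pow]
  · simp [hS]

/-- If `Q_n(0)` is square summable, some solution has no atom at the origin. -/
theorem exists_isMomentSolution_singleton_zero_eq_zero {s : ℕ → ℝ} {S : ℝ} (hS : 0 < S)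
    (h : ∀ p : ℝ[X], momentFunctional s (divDiff 0 p) ^ 2 ≤ S * momentFunctional s (p ^ 2)) :
    ∃ μ : Measure ℝ, IsMomentSolution s μ ∧ μ {0} = 0 := by
  obtain ⟨μ, hμ⟩ := exists_measure_of_nonneg_sq
    (S • leval 0 + momentFunctional s ∘ₗ divDiff 0 ∘ₗ divDiff 0) fun p => by
      set a := p.eval 0
      set q := divDiff 0 p
      have hp : p = C a + (X - C 0) * q := eq_eval_add_mul_divDiff 0 p
      have e : p ^ 2 = C (a ^ 2) + (X - C 0) * ((2 * a) • q + (X - C 0) * q ^ 2) := by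
        rw [hp, smul_eq_C_mul, C_mul, C_pow, map_ofNat]
        ring
      have e2 : divDiff 0 ((X - C 0) * q ^ 2) = q ^ 2 := by
        have e0 : (X - C 0) * q ^ 2 = C 0 + (X - C 0) * q ^ 2 := by rw [C_0, zero_add]
        rw [e0, divDiff_C_add_mul]
      simp only [LinearMap.add_apply, LinearMap.smul_apply, leval_apply, LinearMap.comp_apply,
        smul_eq_mul, eval_pow]
      rw [e, divDiff_C_add_mul, map_add, e2, map_smul, map_add, map_smul, smul_eq_mul]
      have hq := h q
      set t := momentFunctional s (divDiff 0 q)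
      set u := momentFunctional s (q ^ 2)
      refine nonneg_of_mul_nonneg_right (a := S) ?_ hS
      change 0 ≤ S * (S * a ^ 2 + (2 * a * t + u))
      nlinarith [sq_nonneg (S * a + t)]
  have hmeas : Measurable fun x : ℝ => (x ^ 2).toNNReal := by fun_prop
  have hsq : ∀ (k : ℕ) (x : ℝ), (x ^ 2).toNNReal • x ^ k = x ^ (k + 2) := fun k x => by
    rw [NNReal.smul_def, Real.coe_toNNReal _ (sq_nonneg x), smul_eq_mul]
    ring
  refine ⟨μ.withDensity fun x => ((x ^ 2).toNNReal : ENNReal), fun k => ⟨?_, ?_⟩, ?_⟩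
  · rw [integrable_withDensity_iff_integrable_smul hmeas]
    simpa only [hsq] using (hμ (k + 2)).1
  · rw [integral_withDensity_eq_integral_smul hmeas]
    simp only [hsq]
    rw [(hμ (k + 2)).2]
    have e1 : divDiff 0 (X ^ (k + 2) : ℝ[X]) = X ^ (k + 1) := by
      have := divDiff_C_add_mul (0 : ℝ) 0 (X ^ (k + 1))
      rwa [C_0, zero_add, sub_zero, ← pow_succ'] at this
    have e2 : divDiff 0 (X ^ (k + 1) : ℝ[X]) = X ^ k := by
      have := divDiff_C_add_mul (0 : ℝ) 0 (X ^ k)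
      rwa [C_0, zero_add, sub_zero, ← pow_succ'] at this
    simp [e1, e2, momentFunctional_X_pow]
  · rw [withDensity_apply _ (measurableSet_singleton 0), lintegral_singleton]
    simp

theorem not_existsUnique_of_summable {s : ℕ → ℝ} (hs0 : s 0 = 1) {ρ : Measure ℝ}
    (hρ : IsMomentSolution s ρ) (h0 : ∀ n, 0 < hankel s n)
    (hsum : Summable fun n => Pn s n 0 ^ 2 + Qn s ρ n 0 ^ 2) :
    ¬ ∃! μ : Measure ℝ, IsMomentSolution s μ := by
  set S := ∑' n, (Pn s n 0 ^ 2 + Qn s ρ n 0 ^ 2)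
  have hle : ∀ N, ∑ n ∈ Finset.range N, (Pn s n 0 ^ 2 + Qn s ρ n 0 ^ 2) ≤ S := fun N =>
    hsum.sum_le_tsum _ fun n _ => by positivity
  have hP : ∀ p : ℝ[X], p.eval 0 ^ 2 ≤ S * momentFunctional s (p ^ 2) :=
    sq_map_le_of_sum_le _ _ (degree_orthPoly h0) (momentFunctional_orthPoly_mul_orthPoly h0)
      (leval 0) fun N => (Finset.sum_le_sum fun n _ => by
        rw [leval_apply, eval_orthPoly]
        exact le_add_of_nonneg_right (sq_nonneg _)).trans (hle N)
  have hQ : ∀ p : ℝ[X], momentFunctional s (divDiff 0 p) ^ 2 ≤ S * momentFunctional s (p ^ 2) :=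
    sq_map_le_of_sum_le _ _ (degree_orthPoly h0) (momentFunctional_orthPoly_mul_orthPoly h0)
      (momentFunctional s ∘ₗ divDiff 0) fun N => (Finset.sum_le_sum fun n _ => by
        rw [LinearMap.comp_apply, ← Qn_eq_momentFunctional hρ]
        exact le_add_of_nonneg_left (sq_nonneg _)).trans (hle N)
  have hS : 0 < S := by
    have h1 := hP 1
    have h2 := momentFunctional_X_pow s 0
    rw [pow_zero, hs0] at h2
    rw [one_pow, h2] at h1
    simp at h1
    linarith
  obtain ⟨μ, hμ, hμ0⟩ := exists_isMomentSolution_singleton_zero_ne_zero hS hP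
  obtain ⟨ν, hν, hν0⟩ := exists_isMomentSolution_singleton_zero_eq_zero hS hQ
  intro hu
  exact hμ0 (hu.unique hμ hν ▸ hν0)
end

section
open Polynomial Filter Topology

theorem integrable_comp_add_mul_inv_one_add_sq (μ : Measure ℝ) [IsFiniteMeasure μ]
    (f : BoundedContinuousFunction ℝ ℝ) (y : ℝ) :
    Integrable (fun p : ℝ × ℝ => f (p.1 + y * p.2) * (1 + p.2 ^ 2)⁻¹) (μ.prod volume) := by
  have h : Integrable (fun p : ℝ × ℝ => ‖f‖ * (1 + p.2 ^ 2)⁻¹) (μ.prod volume) :=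
    (integrable_const ‖f‖).mul_prod integrable_inv_one_add_sq
  have hc : Continuous fun p : ℝ × ℝ => f (p.1 + y * p.2) * (1 + p.2 ^ 2)⁻¹ :=
    (f.continuous.comp (by fun_prop)).mul
      (Continuous.inv₀ (by fun_prop) fun p => by positivity)
  refine h.mono' hc.aestronglyMeasurable (Eventually.of_forall fun p => ?_)
  rw [norm_mul, Real.norm_of_nonneg (by positivity : 0 ≤ (1 + p.2 ^ 2)⁻¹)]
  gcongr
  exact f.norm_coe_le_norm _

theorem integral_comp_add_mul_inv_one_add_sq (f : ℝ → ℝ) {y : ℝ} (hy : 0 < y) (x : ℝ) :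
    ∫ t, f (x + y * t) * (1 + t ^ 2)⁻¹ = ∫ t, f t * (y / ((x - t) ^ 2 + y ^ 2)) := by
  have h := Measure.integral_comp_mul_left
    (fun t => f (x + t) * (y / ((x - (x + t)) ^ 2 + y ^ 2))) y
  rw [integral_add_left_eq_self (fun t => f t * (y / ((x - t) ^ 2 + y ^ 2))) x,
    abs_of_pos (inv_pos.2 hy), smul_eq_mul] at h
  rw [← mul_right_inj' (inv_ne_zero hy.ne'), ← h, ← integral_const_mul]
  refine integral_congr_ae (Eventually.of_forall fun t => ?_)
  have : (1 + t ^ 2) ≠ 0 := by positivity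
  have : (x - (x + y * t)) ^ 2 + y ^ 2 ≠ 0 := by positivity
  field_simp
  ring

theorem integrable_mul_poisson (μ : Measure ℝ) [IsFiniteMeasure μ]
    (f : BoundedContinuousFunction ℝ ℝ) {y : ℝ} (hy : 0 < y) :
    Integrable (fun p : ℝ × ℝ => f p.2 * (y / ((p.1 - p.2) ^ 2 + y ^ 2))) (μ.prod volume) := by
  have hk : Continuous fun p : ℝ × ℝ => y / ((p.1 - p.2) ^ 2 + y ^ 2) :=
    Continuous.div (by fun_prop) (by fun_prop) fun p => by positivity
  have hx : ∀ x : ℝ, Integrable (fun t : ℝ => y / ((x - t) ^ 2 + y ^ 2)) := fun x => by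
    have h1 := (((integrable_inv_one_add_sq).comp_div hy.ne').comp_sub_left x).const_mul y⁻¹
    refine h1.congr (Eventually.of_forall fun t => ?_)
    have : (x - t) ^ 2 + y ^ 2 ≠ 0 := by positivity
    have : 1 + ((x - t) / y) ^ 2 ≠ 0 := by positivity
    field_simp
    ring
  have hK : Integrable (fun p : ℝ × ℝ => y / ((p.1 - p.2) ^ 2 + y ^ 2)) (μ.prod volume) := by
    refine (integrable_prod_iff hk.aestronglyMeasurable).2
      ⟨Eventually.of_forall hx, (integrable_const Real.pi).congr (Eventually.of_forall fun x => ?_)⟩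
    have h := integral_comp_add_mul_inv_one_add_sq (fun _ => 1) hy x
    simp only [one_mul, integral_univ_inv_one_add_sq] at h
    simp only [h]
    refine integral_congr_ae (Eventually.of_forall fun t => ?_)
    exact (Real.norm_of_nonneg (by positivity)).symm
  refine (hK.const_mul ‖f‖).mono' ((f.continuous.comp continuous_snd).mul hk).aestronglyMeasurable
    (Eventually.of_forall fun p => ?_)
  rw [norm_mul, Real.norm_of_nonneg (by positivity : 0 ≤ y / ((p.1 - p.2) ^ 2 + y ^ 2))]
  gcongr
  exact f.norm_coe_le_norm _

theorem tendsto_integral_comp_add_mul_inv_one_add_sq (μ : Measure ℝ) [IsFiniteMeasure μ]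
    (f : BoundedContinuousFunction ℝ ℝ) :
    Tendsto (fun y : ℝ => ∫ p : ℝ × ℝ, f (p.1 + y * p.2) * (1 + p.2 ^ 2)⁻¹ ∂(μ.prod volume))
      (𝓝[>] 0) (𝓝 ((∫ x, f x ∂μ) * Real.pi)) := by
  rw [← integral_univ_inv_one_add_sq, ← integral_prod_mul]
  refine tendsto_integral_filter_of_dominated_convergence (fun p => ‖f‖ * (1 + p.2 ^ 2)⁻¹)
    (Eventually.of_forall fun y =>
      (integrable_comp_add_mul_inv_one_add_sq μ f y).aestronglyMeasurable)
    (Eventually.of_forall fun y => Eventually.of_forall fun p => ?_)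
    ((integrable_const ‖f‖).mul_prod integrable_inv_one_add_sq)
    (Eventually.of_forall fun p => ?_)
  · rw [norm_mul, Real.norm_of_nonneg (by positivity : 0 ≤ (1 + p.2 ^ 2)⁻¹)]
    gcongr
    exact f.norm_coe_le_norm _
  · have hc : Continuous fun y : ℝ => f (p.1 + y * p.2) * (1 + p.2 ^ 2)⁻¹ :=
      (f.continuous.comp (by fun_prop)).mul continuous_const
    have := hc.tendsto 0
    simp only [zero_mul, add_zero] at this
    exact this.mono_left nhdsWithin_le_nhds

/-- A finite measure on the line is determined by its Poisson integrals. -/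
theorem ext_of_forall_integral_poisson_eq {μ ν : Measure ℝ} [IsFiniteMeasure μ]
    [IsFiniteMeasure ν]
    (h : ∀ a y : ℝ, 0 < y →
      ∫ x, y / ((x - a) ^ 2 + y ^ 2) ∂μ = ∫ x, y / ((x - a) ^ 2 + y ^ 2) ∂ν) : μ = ν := by
  refine ext_of_forall_integral_eq_of_IsFiniteMeasure fun f => ?_
  have key : ∀ (κ : Measure ℝ) [IsFiniteMeasure κ] (y : ℝ), 0 < y →
      ∫ p : ℝ × ℝ, f (p.1 + y * p.2) * (1 + p.2 ^ 2)⁻¹ ∂(κ.prod volume)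
        = ∫ t, f t * ∫ x, y / ((x - t) ^ 2 + y ^ 2) ∂κ := by
    intro κ _ y hy
    rw [integral_prod _ (integrable_comp_add_mul_inv_one_add_sq κ f y)]
    simp only [integral_comp_add_mul_inv_one_add_sq f hy]
    rw [integral_integral_swap (integrable_mul_poisson κ f hy)]
    simp only [integral_const_mul]
  have hμ := tendsto_integral_comp_add_mul_inv_one_add_sq μ f
  have hν := tendsto_integral_comp_add_mul_inv_one_add_sq ν f
  have heq : (fun y : ℝ => ∫ p : ℝ × ℝ, f (p.1 + y * p.2) * (1 + p.2 ^ 2)⁻¹ ∂(μ.prod volume))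
      =ᶠ[𝓝[>] 0]
      fun y : ℝ => ∫ p : ℝ × ℝ, f (p.1 + y * p.2) * (1 + p.2 ^ 2)⁻¹ ∂(ν.prod volume) := by
    filter_upwards [self_mem_nhdsWithin] with y hy
    rw [key μ y hy, key ν y hy]
    simp only [h _ y hy]
  exact mul_right_cancel₀ Real.pi_ne_zero (tendsto_nhds_unique (hμ.congr' heq) hν)

/-- A discrete Gronwall inequality in `ℓ²`. -/
theorem summable_sq_of_le_mul_one_add_sum {γ u : ℕ → ℝ} {c : ℝ} (hc : 0 ≤ c) (hγ : ∀ n, 0 ≤ γ n)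
    (hu : ∀ n, 0 ≤ u n) (hsum : Summable fun n => γ n ^ 2)
    (h : ∀ n, u n ≤ γ n * (1 + c * ∑ k ∈ Finset.range n, γ k * u k)) :
    Summable fun n => u n ^ 2 := by
  set T : ℕ → ℝ := fun n => 1 + c * ∑ k ∈ Finset.range n, γ k * u k with hT
  have hT0 : ∀ n, 0 ≤ T n := fun n => by
    have := Finset.sum_nonneg fun k (_ : k ∈ Finset.range n) => mul_nonneg (hγ k) (hu k)
    positivity
  have hTexp : ∀ n, T n ≤ Real.exp (c * ∑ k ∈ Finset.range n, γ k ^ 2) := by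
    intro n
    induction n with
    | zero => simp [hT]
    | succ n ih =>
      have h1 : T (n + 1) = T n + c * (γ n * u n) := by
        simp only [hT, Finset.sum_range_succ]
        ring
      have h2 : c * (γ n * u n) ≤ c * (γ n * (γ n * T n)) := by
        have := hγ n
        gcongr
        exact h n
      rw [Finset.sum_range_succ, mul_add, Real.exp_add, h1]
      calc T n + c * (γ n * u n) ≤ T n * (c * γ n ^ 2 + 1) := by linarith
        _ ≤ _ := mul_le_mul ih (Real.add_one_le_exp _) (by positivity) (by positivity)
  set M := Real.exp (c * ∑' k, γ k ^ 2)
  have hTM : ∀ n, T n ≤ M := fun n => (hTexp n).trans <| Real.exp_le_exp.2 <| by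
    gcongr
    exact hsum.sum_le_tsum _ fun k _ => sq_nonneg _
  refine (hsum.mul_right (M ^ 2)).of_nonneg_of_le (fun n => sq_nonneg _) fun n => ?_
  rw [← mul_pow]
  have h3 := hγ n
  have h4 := hu n
  gcongr
  exact (h n).trans (by gcongr; exact hTM n)
end

section
open Polynomial Filter Topology

theorem IsMomentSolution.integral_orthPoly_sq_sum_le {s : ℕ → ℝ} (h0 : ∀ n, 0 < hankel s n)
    {μ : Measure ℝ} (h : IsMomentSolution s μ) {g : ℝ → ℝ} (hg : Continuous g) {M : ℝ}
    (hM : ∀ x, |g x| ≤ M) (N : ℕ) :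
    ∑ n ∈ Finset.range N, (∫ x, (orthPoly s n).eval x * g x ∂μ) ^ 2 ≤ ∫ x, g x ^ 2 ∂μ := by
  have := h.isFiniteMeasure
  set b : ℕ → ℝ := fun n => ∫ x, (orthPoly s n).eval x * g x ∂μ
  set p : ℝ[X] := ∑ n ∈ Finset.range N, b n • orthPoly s n with hp
  have hpg : ∀ q : ℝ[X], Integrable (fun x => q.eval x * g x) μ := fun q =>
    (h.integrable_eval q).mul_bdd (c := M) hg.aestronglyMeasurable (Eventually.of_forall hM)
  have hg2 : Integrable (fun x => g x ^ 2) μ := by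
    refine Integrable.of_bound (hg.pow 2).aestronglyMeasurable (M ^ 2)
      (Eventually.of_forall fun x => ?_)
    rw [norm_pow, Real.norm_eq_abs]
    have := hM x
    gcongr
  have h1 : ∫ x, p.eval x * g x ∂μ = ∑ n ∈ Finset.range N, b n ^ 2 := by
    have : ∀ x, p.eval x * g x = ∑ n ∈ Finset.range N, b n * ((orthPoly s n).eval x * g x) :=
      fun x => by simp [hp, eval_finsetSum, Finset.sum_mul, mul_assoc]
    simp only [this]
    rw [integral_finsetSum _ fun n _ => (hpg _).const_mul _]
    exact Finset.sum_congr rfl fun n _ => by rw [integral_const_mul, sq]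
  have h2 : ∫ x, (p ^ 2).eval x ∂μ = ∑ n ∈ Finset.range N, b n ^ 2 := by
    rw [h.integral_eval, sq, hp, Finset.sum_mul_sum, map_sum]
    refine Finset.sum_congr rfl fun n hn => ?_
    simp only [map_sum, smul_mul_smul_comm, map_smul,
      momentFunctional_orthPoly_mul_orthPoly h0, smul_eq_mul]
    simp only [mul_ite, mul_one, mul_zero, Finset.sum_ite_eq, if_pos hn, sq]
  have h3 : 0 ≤ ∫ x, (g x ^ 2 - 2 * (p.eval x * g x) + (p ^ 2).eval x) ∂μ :=
    integral_nonneg fun x => by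
      have := sq_nonneg (g x - p.eval x)
      simp only [eval_pow, Pi.zero_apply]
      linarith
  rw [integral_add (f := fun x => g x ^ 2 - 2 * (p.eval x * g x)) (hg2.sub ((hpg p).const_mul 2))
      (h.integrable_eval (p ^ 2)),
    integral_sub hg2 ((hpg p).const_mul 2), integral_const_mul, h1, h2] at h3
  linarith

theorem continuous_inv_ofReal_sub {z : ℂ} (hz : z.im ≠ 0) :
    Continuous fun x : ℝ => ((x : ℂ) - z)⁻¹ := by
  refine Continuous.inv₀ (by fun_prop) fun x h => hz ?_
  simpa using congrArg Complex.im h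

theorem norm_inv_ofReal_sub_le {z : ℂ} (hz : z.im ≠ 0) (x : ℝ) : ‖((x : ℂ) - z)⁻¹‖ ≤ |z.im|⁻¹ := by
  have := abs_pos.2 hz
  rw [norm_inv]
  gcongr
  simpa using Complex.abs_im_le_norm ((x : ℂ) - z)

theorem IsMomentSolution.integrable_ofReal_eval_mul {s : ℕ → ℝ} {μ : Measure ℝ}
    (h : IsMomentSolution s μ) (p : ℝ[X]) {z : ℂ} (hz : z.im ≠ 0) :
    Integrable (fun x : ℝ => ((p.eval x : ℝ) : ℂ) * ((x : ℂ) - z)⁻¹) μ :=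
  (h.integrable_eval p).ofReal.mul_bdd (c := |z.im|⁻¹)
    (continuous_inv_ofReal_sub hz).aestronglyMeasurable
    (Eventually.of_forall (norm_inv_ofReal_sub_le hz))

theorem IsMomentSolution.summable_norm_sq_integral {s : ℕ → ℝ} (h0 : ∀ n, 0 < hankel s n)
    {μ : Measure ℝ} (h : IsMomentSolution s μ) {z : ℂ} (hz : z.im ≠ 0) :
    Summable fun n =>
      ‖∫ x : ℝ, (((orthPoly s n).eval x : ℝ) : ℂ) * ((x : ℂ) - z)⁻¹ ∂μ‖ ^ 2 := by
  have hc := continuous_inv_ofReal_sub hz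
  refine summable_of_sum_range_le (c := (∫ x : ℝ, ((x : ℂ) - z)⁻¹.re ^ 2 ∂μ) +
    ∫ x : ℝ, ((x : ℂ) - z)⁻¹.im ^ 2 ∂μ) (fun n => by positivity) fun N => ?_
  have hre := h.integral_orthPoly_sq_sum_le h0 (Complex.continuous_re.comp hc) (fun x =>
    (Complex.abs_re_le_norm _).trans (norm_inv_ofReal_sub_le hz x)) N
  have him := h.integral_orthPoly_sq_sum_le h0 (Complex.continuous_im.comp hc) (fun x =>
    (Complex.abs_im_le_norm _).trans (norm_inv_ofReal_sub_le hz x)) N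
  refine le_trans (le_of_eq ?_) (add_le_add hre him)
  rw [← Finset.sum_add_distrib]
  refine Finset.sum_congr rfl fun n _ => ?_
  have hi := h.integrable_ofReal_eval_mul (orthPoly s n) hz
  have e1 := integral_re hi
  have e2 := integral_im hi
  simp only [RCLike.re_eq_complex_re, RCLike.im_eq_complex_im, Complex.re_ofReal_mul,
    Complex.im_ofReal_mul] at e1 e2
  rw [Complex.sq_norm, Complex.normSq_apply, ← e1, ← e2, ← sq, ← sq]
  rfl

theorem IsMomentSolution.integrable_integral_complex_eval {s : ℕ → ℝ} {μ : Measure ℝ}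
    (h : IsMomentSolution s μ) (p : ℂ[X]) :
    Integrable (fun x : ℝ => p.eval (x : ℂ)) μ ∧
      ∫ x : ℝ, p.eval (x : ℂ) ∂μ = momentFunctional (fun k => (s k : ℂ)) p := by
  induction p using Polynomial.induction_on' with
  | add p q hp hq =>
    simp only [eval_add, map_add]
    exact ⟨hp.1.add hq.1, by rw [integral_add hp.1 hq.1, hp.2, hq.2]⟩
  | monomial n a =>
    have hi : Integrable (fun x : ℝ => (x : ℂ) ^ n) μ := by
      simpa using (h n).1.ofReal (𝕜 := ℂ)
    simp only [← C_mul_X_pow_eq_monomial, eval_mul, eval_C, eval_pow, eval_X,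
      momentFunctional_C_mul_X_pow]
    refine ⟨hi.const_mul a, ?_⟩
    rw [integral_const_mul, ← (h n).2]
    congr 1
    simpa using integral_ofReal (μ := μ) (𝕜 := ℂ) (f := fun x : ℝ => x ^ n)

/-- The Stieltjes transform of `p dμ`, in terms of the divided difference of `p` and the Stieltjes
transform of `μ`. -/
theorem IsMomentSolution.integral_mul_inv_sub {s : ℕ → ℝ} {μ : Measure ℝ}
    (h : IsMomentSolution s μ) (p : ℝ[X]) {z : ℂ} (hz : z.im ≠ 0) :
    ∫ x : ℝ, ((p.eval x : ℝ) : ℂ) * ((x : ℂ) - z)⁻¹ ∂μ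
      = momentFunctional (fun k => (s k : ℂ)) (divDiff z (p.map (algebraMap ℝ ℂ)))
        + (p.map (algebraMap ℝ ℂ)).eval z * ∫ x : ℝ, ((x : ℂ) - z)⁻¹ ∂μ := by
  have hd := h.integrable_integral_complex_eval (divDiff z (p.map (algebraMap ℝ ℂ)))
  have hi : Integrable (fun x : ℝ => ((x : ℂ) - z)⁻¹) μ := by
    simpa using h.integrable_ofReal_eval_mul 1 hz
  rw [← hd.2, ← integral_const_mul, ← integral_add hd.1 (hi.const_mul _)]
  congr 1
  ext x
  have hne : (x : ℂ) - z ≠ 0 := fun h' => hz (by simpa using congrArg Complex.im h')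
  have e := congrArg (eval (x : ℂ)) (eq_eval_add_mul_divDiff z (p.map (algebraMap ℝ ℂ)))
  have e' : (p.map (algebraMap ℝ ℂ)).eval (x : ℂ) = ((p.eval x : ℝ) : ℂ) := by
    rw [← Complex.coe_algebraMap, eval_map_algebraMap, aeval_algebraMap_apply]
    simp
  rw [e'] at e
  rw [e]
  simp only [eval_add, eval_mul, eval_C, eval_sub, eval_X]
  field_simp
  ring

/-- Two solutions whose Stieltjes transforms differ at a nonreal point force square
summability at the origin. -/
theorem summable_of_stieltjes_ne {s : ℕ → ℝ} (h0 : ∀ n, 0 < hankel s n) {ρ μ ν : Measure ℝ}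
    (hρ : IsMomentSolution s ρ) (hμ : IsMomentSolution s μ) (hν : IsMomentSolution s ν) {z : ℂ}
    (hz : z.im ≠ 0) (hne : ∫ x : ℝ, ((x : ℂ) - z)⁻¹ ∂μ ≠ ∫ x : ℝ, ((x : ℂ) - z)⁻¹ ∂ν) :
    Summable fun n => Pn s n 0 ^ 2 + Qn s ρ n 0 ^ 2 := by
  set F := ∫ x : ℝ, ((x : ℂ) - z)⁻¹ ∂μ
  set G := ∫ x : ℝ, ((x : ℂ) - z)⁻¹ ∂ν
  set P : ℕ → ℂ[X] := fun n => (orthPoly s n).map (algebraMap ℝ ℂ) with hP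
  set L := momentFunctional fun k => (s k : ℂ)
  set Q : ℕ → ℂ := fun n => L (divDiff z (P n))
  have hdeg : ∀ n, (P n).degree = n := fun n => by rw [hP, degree_map, degree_orthPoly h0]
  have horth : ∀ m n, L (P m * P n) = if m = n then 1 else 0 := fun m n => by
    have := momentFunctional_map (algebraMap ℝ ℂ) s (orthPoly s m * orthPoly s n)
    rw [Polynomial.map_mul, momentFunctional_orthPoly_mul_orthPoly h0] at this
    refine this.trans ?_
    split_ifs <;> simp
  have hcμ := hμ.summable_norm_sq_integral h0 hz
  have hcν := hν.summable_norm_sq_integral h0 hz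
  simp only [hμ.integral_mul_inv_sub _ hz, hν.integral_mul_inv_sub _ hz] at hcμ hcν
  change Summable fun n => ‖Q n + (P n).eval z * F‖ ^ 2 at hcμ
  change Summable fun n => ‖Q n + (P n).eval z * G‖ ^ 2 at hcν
  have hFG : 0 < ‖F - G‖ := norm_pos_iff.2 (sub_ne_zero.2 hne)
  have hPsum : Summable fun n => ‖(P n).eval z‖ ^ 2 := by
    refine ((hcμ.add hcν).mul_left (2 / ‖F - G‖ ^ 2)).of_nonneg_of_le (fun n => by positivity)
      fun n => ?_
    rw [div_mul_eq_mul_div, le_div_iff₀ (by positivity), ← mul_pow, ← norm_mul]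
    have e : (P n).eval z * (F - G) = (Q n + (P n).eval z * F) - (Q n + (P n).eval z * G) := by
      ring
    rw [e]
    have := norm_sub_le (Q n + (P n).eval z * F) (Q n + (P n).eval z * G)
    refine (pow_le_pow_left₀ (norm_nonneg _) this 2).trans ?_
    exact add_sq_le
  have hQsum : Summable fun n => ‖Q n‖ ^ 2 := by
    refine ((hcμ.add (hPsum.mul_left (‖F‖ ^ 2))).mul_left 2).of_nonneg_of_le
      (fun n => by positivity) fun n => ?_
    have := norm_sub_le (Q n + (P n).eval z * F) ((P n).eval z * F)
    rw [add_sub_cancel_right] at this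
    refine (pow_le_pow_left₀ (norm_nonneg _) this 2).trans (add_sq_le.trans (le_of_eq ?_))
    rw [norm_mul]
    ring
  set γ : ℕ → ℝ := fun n => ‖(P n).eval z‖ + ‖Q n‖ with hγ
  have hγ0 : ∀ n, 0 ≤ γ n := fun n => by positivity
  have hγsum : Summable fun n => γ n ^ 2 :=
    ((hPsum.add hQsum).mul_left 2).of_nonneg_of_le (fun n => by positivity) fun n => add_sq_le
  have hbound : ∀ (u : ℕ → ℂ) (b : ℕ → ℂ), (∀ n, ‖b n‖ ≤ γ n) →
      (∀ n, u n = b n + (0 - z) * ∑ k ∈ Finset.range n,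
        (Q n * (P k).eval z - (P n).eval z * Q k) * u k) → Summable fun n => ‖u n‖ ^ 2 := by
    intro u b hb hu
    refine summable_sq_of_le_mul_one_add_sum (norm_nonneg z) hγ0 (fun n => norm_nonneg _) hγsum
      fun n => ?_
    have hsum : ‖∑ k ∈ Finset.range n, (Q n * (P k).eval z - (P n).eval z * Q k) * u k‖
        ≤ γ n * ∑ k ∈ Finset.range n, γ k * ‖u k‖ := by
      rw [Finset.mul_sum]
      refine norm_sum_le_of_le _ fun k _ => ?_
      rw [norm_mul, ← mul_assoc]
      gcongr
      refine (norm_sub_le _ _).trans ?_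
      rw [norm_mul, norm_mul]
      simp only [hγ]
      nlinarith [mul_nonneg (norm_nonneg (Q n)) (norm_nonneg (Q k)),
        mul_nonneg (norm_nonneg ((P n).eval z)) (norm_nonneg ((P k).eval z))]
    rw [hu n]
    refine (norm_add_le _ _).trans ?_
    rw [norm_mul, zero_sub, norm_neg]
    calc _ ≤ γ n + ‖z‖ * (γ n * ∑ k ∈ Finset.range n, γ k * ‖u k‖) := by
          gcongr
          exact hb n
      _ = _ := by ring
  have h1 := hbound (fun n => (P n).eval 0) (fun n => (P n).eval z)
    (fun n => le_add_of_nonneg_right (norm_nonneg _))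
    fun n => eval_eq_add_sum L P hdeg horth z 0 n
  have h2 := hbound (fun n => L (divDiff 0 (P n))) Q
    (fun n => le_add_of_nonneg_left (norm_nonneg _))
    fun n => map_divDiff_eq_add_sum L P hdeg horth z 0 n
  refine (h1.add h2).congr fun n => ?_
  have e1 : (P n).eval 0 = (Pn s n 0 : ℂ) := by
    have := aeval_algebraMap_apply ℂ (0 : ℝ) (orthPoly s n)
    rw [map_zero] at this
    rw [hP, eval_map_algebraMap, this, coe_aeval_eq_eval, eval_orthPoly]
    rfl
  have e2 : L (divDiff 0 (P n)) = (Qn s ρ n 0 : ℂ) := by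
    rw [Qn_eq_momentFunctional hρ, ← Complex.coe_algebraMap,
      ← momentFunctional_map (algebraMap ℝ ℂ)]
    change L _ = L _
    congr 1
    have e := congrArg (Polynomial.map (algebraMap ℝ ℂ)) (eq_eval_add_mul_divDiff 0 (orthPoly s n))
    rw [Polynomial.map_add, Polynomial.map_mul, Polynomial.map_sub, map_C, map_C, map_X,
      map_zero] at e
    change divDiff 0 ((orthPoly s n).map (algebraMap ℝ ℂ)) = _
    rw [e, divDiff_C_add_mul]
  rw [e1, e2, Complex.norm_real, Complex.norm_real, Real.norm_eq_abs, Real.norm_eq_abs, sq_abs,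
    sq_abs]

theorem existsUnique_of_not_summable {s : ℕ → ℝ} (h0 : ∀ n, 0 < hankel s n) {ρ : Measure ℝ}
    (hρ : IsMomentSolution s ρ) (hsum : ¬ Summable fun n => Pn s n 0 ^ 2 + Qn s ρ n 0 ^ 2) :
    ∃! μ : Measure ℝ, IsMomentSolution s μ := by
  refine ⟨ρ, hρ, fun μ hμ => ?_⟩
  have := hρ.isFiniteMeasure
  have := hμ.isFiniteMeasure
  refine ext_of_forall_integral_poisson_eq fun a y hy => ?_
  have hz : (⟨a, y⟩ : ℂ).im ≠ 0 := hy.ne'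
  have key : ∀ κ : Measure ℝ, IsMomentSolution s κ →
      ∫ x, y / ((x - a) ^ 2 + y ^ 2) ∂κ = (∫ x : ℝ, ((x : ℂ) - ⟨a, y⟩)⁻¹ ∂κ).im := by
    intro κ hκ
    have hi : Integrable (fun x : ℝ => ((x : ℂ) - ⟨a, y⟩)⁻¹) κ := by
      simpa using hκ.integrable_ofReal_eval_mul 1 hz
    have e := integral_im hi
    simp only [RCLike.im_eq_complex_im] at e
    rw [← e]
    congr 1
    ext x
    simp [Complex.inv_im, Complex.normSq_apply, sq]
  rw [key μ hμ, key ρ hρ]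
  by_contra hne
  exact hsum (summable_of_stieltjes_ne h0 hρ hμ hρ hz fun h => hne (congrArg Complex.im h))
end

section
open Polynomial

theorem summable_iff_of_sum_range_strictMono {f g : ℕ → ℝ} (hf : ∀ n, 0 ≤ f n)
    (hg : ∀ j, 0 ≤ g j) {k : ℕ → ℕ} (hk : StrictMono k) {c : ℝ}
    (h : ∀ J, ∑ n ∈ Finset.range (k J + 1), f n = c + ∑ j ∈ Finset.range J, g j) :
    Summable g ↔ Summable f := by
  constructor <;> intro hs
  · refine summable_of_sum_range_le (c := c + ∑' j, g j) hf fun N => ?_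
    refine (Finset.sum_le_sum_of_subset_of_nonneg (Finset.range_subset_range.2
      ((hk.id_le N).trans (Nat.le_succ _))) fun n _ _ => hf n).trans ?_
    rw [h]
    gcongr
    exact hs.sum_le_tsum _ fun j _ => hg j
  · refine summable_of_sum_range_le (c := (∑' n, f n) - c) hg fun J => ?_
    rw [le_sub_iff_add_le', ← h]
    exact hs.sum_le_tsum _ fun n _ => hf n

theorem Qn_zero {s : ℕ → ℝ} (h0 : ∀ n, 0 < hankel s n) {ρ : Measure ℝ}
    (hρ : IsMomentSolution s ρ) (z : ℝ) : Qn s ρ 0 z = 0 := by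
  have h := divDiff_C_add_mul z ((orthPoly s 0).coeff 0) 0
  rw [mul_zero, add_zero, ← eq_C_of_degree_le_zero (degree_orthPoly h0 0).le] at h
  rw [Qn_eq_momentFunctional hρ, h, map_zero]

/-- `P_n` and `P_{n+1}` have no common zero. -/
theorem Pn_ne_zero_or_Pn_succ_ne_zero {s : ℕ → ℝ} (h0 : ∀ n, 0 < hankel s n) (n : ℕ) (z : ℝ) :
    Pn s n z ≠ 0 ∨ Pn s (n + 1) z ≠ 0 := by
  simpa only [eval_orthPoly] using eval_ne_zero_or_eval_succ_ne_zero (momentFunctional s)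
    (orthPoly s) (degree_orthPoly h0) (momentFunctional_orthPoly_mul_orthPoly h0) z n

theorem StrictMono.apply_eq_zero_of_lt_of_lt {k : ℕ → ℕ} (hk : StrictMono k) {f : ℕ → ℝ}
    (hall : ∀ n, f n ≠ 0 → ∃ j, k j = n) {j n : ℕ} (h1 : k j < n) (h2 : n < k (j + 1)) :
    f n = 0 := by
  by_contra hn
  obtain ⟨i, rfl⟩ := hall n hn
  have := hk.lt_iff_lt.1 h1
  have := hk.lt_iff_lt.1 h2
  omega

/-- The string data of the blocks `(k j, k (j + 1)]` add up to `∑ (P_n(0)² + Q_n(0)²)`. -/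
theorem sum_range_sq_add_sq_eq {s : ℕ → ℝ} (h0 : ∀ n, 0 < hankel s n) {ρ : Measure ℝ}
    (hρ : IsMomentSolution s ρ) {k : ℕ → ℕ} (hk0 : k 0 = 0) (hk : StrictMono k)
    (hall : ∀ n, Pn s n 0 ≠ 0 → ∃ j, k j = n) (J : ℕ) :
    ∑ n ∈ Finset.range (k J + 1), (Pn s n 0 ^ 2 + Qn s ρ n 0 ^ 2) = Pn s 0 0 ^ 2 +
      ∑ j ∈ Finset.range J, (Pn s (k (j + 1)) 0 ^ 2 + Qn s ρ (k (j + 1)) 0 ^ 2 +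
        if k (j + 1) = k j + 1 then 0 else Qn s ρ (k j + 1) 0 ^ 2) := by
  induction J with
  | zero => simp [hk0, Qn_zero h0 hρ]
  | succ J ih =>
    have hlt : k J < k (J + 1) := hk J.lt_succ_self
    rw [Finset.sum_range_succ _ J, ← add_assoc, ← ih]
    split_ifs with h
    · rw [h, Finset.sum_range_succ _ (k J + 1), add_zero]
    · have hz : Pn s (k J + 1) 0 = 0 :=
        hk.apply_eq_zero_of_lt_of_lt (j := J) hall (by omega) (by omega)
      have h2 : k (J + 1) = k J + 2 := by
        by_contra h'
        exact (Pn_ne_zero_or_Pn_succ_ne_zero h0 (k J + 1) 0).elim (fun h => h hz) fun h =>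
          h (hk.apply_eq_zero_of_lt_of_lt (j := J) hall (by omega) (by omega))
      rw [h2, Finset.sum_range_succ _ (k J + 2), Finset.sum_range_succ _ (k J + 1), hz]
      ring
end

/-- For a strictly positive moment sequence with `s_0 = 1` and associated Krein–Langer
string data `l_n`, `ω_n`, `υ_n` (built from the orthogonal polynomials via the
enumeration `k(j)` of indices `n` with `P_n(0) ≠ 0`), the Hamburger moment problem is
determinate if and only if the series `Σ_n (l_{n+1} + l_{n+1} w_n² + υ_n)` diverges,
where `w_n = Σ_{k≤n} ω_k`; equivalently, iff `Σ_n (|P_n(0)|² + |Q_n(0)|²) = ∞`. -/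
theorem determinacy_krein_langer_string (s : ℕ → ℝ) (hs0 : s 0 = 1)
    (ρ : Measure ℝ) [IsProbabilityMeasure ρ] (hρ : IsMomentSolution s ρ)
    (h0 : ∀ n, 0 < hankel s n)
    (k : ℕ → ℕ) (hk0 : k 0 = 0) (hkmono : StrictMono k)
    (hkne : ∀ j, Pn s (k j) 0 ≠ 0)
    (hkall : ∀ n, Pn s n 0 ≠ 0 → ∃ j, k j = n)
    (l ω υ w : ℕ → ℝ)
    (hl : ∀ j, l j = (Pn s (k j) 0) ^ 2)
    (hω : ∀ j, ω j = Qn s ρ (k j) 0 / Pn s (k j) 0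
      - Qn s ρ (k (j + 1)) 0 / Pn s (k (j + 1)) 0)
    (hυ : ∀ j, υ j = if k (j + 1) = k j + 1 then 0 else (Qn s ρ (k j + 1) 0) ^ 2)
    (hw : ∀ n, w n = ∑ i ∈ Finset.range (n + 1), ω i) :
    ((∃! ρ' : Measure ℝ, IsMomentSolution s ρ') ↔
      ¬ Summable (fun n => l (n + 1) + l (n + 1) * (w n) ^ 2 + υ n)) ∧
    ((∃! ρ' : Measure ℝ, IsMomentSolution s ρ') ↔
      ¬ Summable (fun n => (Pn s n 0) ^ 2 + (Qn s ρ n 0) ^ 2)) := by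
  have hdet : (∃! ρ' : Measure ℝ, IsMomentSolution s ρ') ↔
      ¬ Summable fun n => Pn s n 0 ^ 2 + Qn s ρ n 0 ^ 2 :=
    ⟨fun hu hsum => not_existsUnique_of_summable hs0 hρ h0 hsum hu,
      existsUnique_of_not_summable h0 hρ⟩
  refine ⟨hdet.trans (not_congr ?_), hdet⟩
  have hw' : ∀ n, w n = -(Qn s ρ (k (n + 1)) 0 / Pn s (k (n + 1)) 0) := fun n => by
    simp only [hw, hω]
    rw [Finset.sum_range_sub' fun j => Qn s ρ (k j) 0 / Pn s (k j) 0, hk0, Qn_zero h0 hρ]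
    ring
  have hg : ∀ n, l (n + 1) + l (n + 1) * w n ^ 2 + υ n =
      Pn s (k (n + 1)) 0 ^ 2 + Qn s ρ (k (n + 1)) 0 ^ 2 +
        if k (n + 1) = k n + 1 then 0 else Qn s ρ (k n + 1) 0 ^ 2 := fun n => by
    have := hkne (n + 1)
    rw [hl, hυ, hw', neg_sq, div_pow, mul_div_cancel₀ _ (pow_ne_zero 2 this)]
  simp only [hg]
  refine (summable_iff_of_sum_range_strictMono (fun n => by positivity) (fun j => ?_) hkmono
    (sum_range_sq_add_sq_eq h0 hρ hk0 hkmono hkall)).symm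
  split_ifs <;> positivity
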